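/- For all φ₁, ψ₁, φ₂, ψ₂ ∈ L²(ℝⁿ), the Fourier–Wigner transforms T_d(φ₁, ψ₁) and T_d(φ₂, ψ₂) lie in L²(ℝ²ⁿ) and satisfy the orthogonality relation ∫_{ℝ²ⁿ} T_d(φ₁, ψ₁)(v) conj(T_d(φ₂, ψ₂)(v)) dv = c(d) ⟨φ₁, φ₂⟩ conj(⟨ψ₁, ψ₂⟩), where c(d) = (2π)ⁿ / ∏_{j=1}^n d_j. -/

import Mathlib

open MeasureTheory Complex

noncomputable section

/-- ℝⁿ with the Euclidean structure. -/
abbrev En (n : ℕ) := EuclideanSpace ℝ (Fin n)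

/-- The representation π_d(x,y) acting on functions:
`(π_d(x,y)φ)(ξ) = exp(i ∑_j d_j (x_j ξ_j + (1/2) x_j y_j)) φ(ξ + y)`. -/
def piD {n : ℕ} (d : Fin n → ℝ) (x y : En n) (φ : En n → ℂ) : En n → ℂ :=
  fun ξ =>
    Complex.exp (Complex.I *
      ((∑ j, d j * (x j * ξ j + (1 / 2) * (x j * y j)) : ℝ) : ℂ)) * φ (ξ + y)

/-- The Fourier–Wigner transform `T_d(φ,ψ)(x,y) = ⟨π_d(x,y)φ, ψ⟩`, with the
inner product `⟨u,v⟩ = ∫ u(ξ) conj(v(ξ)) dξ`. -/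
def Td {n : ℕ} (d : Fin n → ℝ) (φ ψ : En n → ℂ) (v : En n × En n) : ℂ :=
  ∫ ξ : En n, piD d v.1 v.2 φ ξ * (starRingEnd ℂ) (ψ ξ)



open FourierTransform in
lemma fw_ae {n : ℕ} (f : En n → ℂ) (h1 : Integrable f) (h2 : MemLp f 2 volume) :
    (𝓕 f : En n → ℂ) =ᵐ[volume] ((𝓕 (h2.toLp f) : Lp ℂ 2 (volume : Measure (En n))) : En n → ℂ) := by
  have hcont : Continuous (𝓕 f : En n → ℂ) :=
    VectorFourier.fourierIntegral_continuous Real.continuous_fourierChar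
      (by exact continuous_inner) h1
  refine ae_eq_of_integral_contDiff_smul_eq hcont.locallyIntegrable
    ((Lp.memLp _).locallyIntegrable (by norm_num)) ?_
  intro g g_smooth g_cpt
  have hg₁ : HasCompactSupport (Complex.ofRealCLM ∘ g) := g_cpt.comp_left rfl
  have hg₂ : ContDiff ℝ ((⊤ : ℕ∞) : WithTop ℕ∞) (Complex.ofRealCLM ∘ g) := by fun_prop
  set G := hg₁.toSchwartzMap hg₂ with hG
  have hGx : ∀ x, G x = (g x : ℂ) := fun x => rfl
  have key := congrArg (fun T => T G) (Lp.fourier_toTemperedDistribution_eq (h2.toLp f))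
  simp only [TemperedDistribution.fourier_apply, Lp.toTemperedDistribution_apply] at key
  have e1 : ∫ x, (𝓕 G) x • (h2.toLp f : En n → ℂ) x = ∫ x, (𝓕 G) x • f x := by
    apply integral_congr_ae
    filter_upwards [h2.coeFn_toLp] with x hx
    rw [hx]
  have e2 : ∫ x, (𝓕 G) x • f x = ∫ x, G x • (𝓕 f) x := by
    have := (VectorFourier.integral_fourierIntegral_smul_eq_flip (L := innerₗ (En n))
      Real.continuous_fourierChar continuous_inner (G.integrable (μ := volume)) h1)
    rw [SchwartzMap.fourier_coe]
    simpa using! this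
  have e3 : ∀ x, ∀ z : ℂ, g x • z = G x • z := fun x z => by simp [hGx]
  simp only [e3]
  rw [← e2, ← e1, key]

open FourierTransform in
lemma fw_plancherel {n : ℕ} (f g : En n → ℂ) (h1 : Integrable f) (h2 : MemLp f 2 volume)
    (k1 : Integrable g) (k2 : MemLp g 2 volume) :
    MemLp (𝓕 f : En n → ℂ) 2 volume ∧
    ∫ x, (𝓕 f : En n → ℂ) x * (starRingEnd ℂ) ((𝓕 g : En n → ℂ) x) =
      ∫ x, f x * (starRingEnd ℂ) (g x) := by
  refine ⟨(memLp_congr_ae (fw_ae f h1 h2)).2 (Lp.memLp _), ?_⟩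
  have := Lp.inner_fourier_eq (k2.toLp g) (h2.toLp f)
  rw [L2.inner_def, L2.inner_def] at this
  simp only [RCLike.inner_apply] at this
  calc _ = _ := integral_congr_ae ?_
    _ = _ := this
    _ = _ := integral_congr_ae ?_
  · filter_upwards [fw_ae f h1 h2, fw_ae g k1 k2] with x hx hy
    rw [hx, hy]
  · filter_upwards [h2.coeFn_toLp, k2.coeFn_toLp] with x hx hy
    rw [hx, hy]

def fwL {n : ℕ} (d : Fin n → ℝ) : En n →ₗ[ℝ] En n :=
  Matrix.toLin (EuclideanSpace.basisFun (Fin n) ℝ).toBasis (EuclideanSpace.basisFun (Fin n) ℝ).toBasis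
    (Matrix.diagonal fun j => -(d j) / (2 * Real.pi))

lemma fwL_apply {n : ℕ} (d : Fin n → ℝ) (x : En n) (j : Fin n) :
    fwL d x j = -(d j) / (2 * Real.pi) * x j := by
  simp [fwL, Matrix.toLin_apply, Matrix.mulVec_diagonal, Finset.sum_apply, Pi.single_apply]

lemma fwL_det {n : ℕ} (d : Fin n → ℝ) :
    LinearMap.det (fwL d) = ∏ j, (-(d j) / (2 * Real.pi)) := by
  rw [fwL, LinearMap.det_toLin, Matrix.det_diagonal]

lemma fw_const {n : ℕ} (d : Fin n → ℝ) (hd : ∀ j, 0 < d j) :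
    |(LinearMap.det (fwL d))⁻¹| = (2 * Real.pi) ^ n / ∏ j, d j := by
  rw [fwL_det, abs_inv, Finset.abs_prod]
  have : ∀ j, |(-(d j) / (2 * Real.pi))| = d j / (2 * Real.pi) := fun j => by
    rw [abs_div, abs_neg, abs_of_pos (hd j), abs_of_pos (by positivity)]
  simp [this, Finset.prod_div_distrib]

lemma fw_det_ne {n : ℕ} (d : Fin n → ℝ) (hd : ∀ j, 0 < d j) : LinearMap.det (fwL d) ≠ 0 := by
  rw [fwL_det]
  refine Finset.prod_ne_zero_iff.2 fun j _ => ?_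
  have := hd j
  have := Real.pi_pos
  exact div_ne_zero (by linarith) (by positivity)

open FourierTransform in
lemma Td_eq {n : ℕ} (d : Fin n → ℝ) (φ ψ : En n → ℂ) (x y : En n) :
    Td d φ ψ (x, y) = Complex.exp (Complex.I * ((∑ j, d j * ((1 / 2) * (x j * y j)) : ℝ) : ℂ)) *
      (𝓕 (fun ξ => φ (ξ + y) * (starRingEnd ℂ) (ψ ξ)) : En n → ℂ) (fwL d x) := by
  rw [Real.fourier_eq', ← integral_const_mul]
  unfold Td piD
  refine integral_congr_ae (Filter.Eventually.of_forall fun ξ => ?_)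
  simp only [smul_eq_mul]
  rw [← mul_assoc, ← Complex.exp_add, ← mul_assoc]
  congr 3
  rw [mul_comm Complex.I, mul_comm Complex.I, ← add_mul, ← Complex.ofReal_add]
  congr 2
  simp only [PiLp.inner_apply, fwL_apply, Finset.mul_sum, ← Finset.sum_add_distrib]
  refine Finset.sum_congr rfl fun j _ => ?_
  simp
  field_simp
  ring

lemma fw_slice {n : ℕ} (d : Fin n → ℝ) (hd : ∀ j, 0 < d j) (φ₁ ψ₁ φ₂ ψ₂ : En n → ℂ) (y : En n)
    (h1 : Integrable (fun ξ => φ₁ (ξ + y) * (starRingEnd ℂ) (ψ₁ ξ)))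
    (h2 : MemLp (fun ξ => φ₁ (ξ + y) * (starRingEnd ℂ) (ψ₁ ξ)) 2 volume)
    (k1 : Integrable (fun ξ => φ₂ (ξ + y) * (starRingEnd ℂ) (ψ₂ ξ)))
    (k2 : MemLp (fun ξ => φ₂ (ξ + y) * (starRingEnd ℂ) (ψ₂ ξ)) 2 volume) :
    MemLp (fun x => Td d φ₁ ψ₁ (x, y)) 2 volume ∧
    ∫ x, Td d φ₁ ψ₁ (x, y) * (starRingEnd ℂ) (Td d φ₂ ψ₂ (x, y)) =
      (((2 * Real.pi) ^ n / ∏ j, d j : ℝ) : ℂ) *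
      ∫ ξ, φ₁ (ξ + y) * (starRingEnd ℂ) (ψ₁ ξ) *
        (starRingEnd ℂ) (φ₂ (ξ + y) * (starRingEnd ℂ) (ψ₂ ξ)) := by
  obtain ⟨p1, p2⟩ := fw_plancherel _ _ h1 h2 k1 k2
  obtain ⟨p3, -⟩ := fw_plancherel _ _ k1 k2 h1 h2
  have hmap := Measure.map_linearMap_addHaar_eq_smul_addHaar (volume : Measure (En n))
    (fw_det_ne d hd)
  have hLc : Continuous (fwL d) := LinearMap.continuous_of_finiteDimensional _
  constructor
  · have q : MemLp (fun x => (FourierTransform.fourier (fun ξ => φ₁ (ξ + y) * (starRingEnd ℂ) (ψ₁ ξ)) : En n → ℂ) (fwL d x)) 2 volume := by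
      refine MemLp.comp_of_map (f := fwL d) ?_ hLc.aemeasurable
      rw [hmap]
      exact p1.smul_measure ENNReal.ofReal_ne_top
    refine q.of_le ?_ ?_
    · simp only [Td_eq]
      refine AEStronglyMeasurable.mul ?_ q.1
      apply Continuous.aestronglyMeasurable
      fun_prop
    · refine Filter.Eventually.of_forall fun x => ?_
      rw [Td_eq, norm_mul, mul_comm Complex.I, Complex.norm_exp_ofReal_mul_I, one_mul]
  · rw [← p2, ← fw_const d hd, ← Complex.real_smul]
    rw [← ENNReal.toReal_ofReal (abs_nonneg (LinearMap.det (fwL d))⁻¹), ← integral_smul_measure, ← hmap,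
      integral_map hLc.aemeasurable]
    · refine integral_congr_ae (Filter.Eventually.of_forall fun x => ?_)
      simp only [Td_eq, map_mul]
      rw [mul_mul_mul_comm, Complex.mul_conj, mul_comm Complex.I, Complex.normSq_eq_norm_sq,
        Complex.norm_exp_ofReal_mul_I]
      simp
    · rw [hmap]
      exact (p1.1.mul (Complex.continuous_conj.comp_aestronglyMeasurable p3.1)).smul_measure _

lemma fw_shear {n : ℕ} (u v : En n → ℂ) (hu : Integrable u) (hv : Integrable v) :
    Integrable (fun p : En n × En n => u (p.1 + p.2) * v p.1) (volume.prod volume) ∧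
    ∫ y, ∫ ξ, u (ξ + y) * v ξ = (∫ ξ, u ξ) * ∫ ξ, v ξ := by
  have hmp := measurePreserving_prod_add (volume : Measure (En n)) (volume : Measure (En n))
  have hi : Integrable (fun p : En n × En n => v p.1 * u p.2) (volume.prod volume) :=
    hv.mul_prod hu
  have h := hmp.integrable_comp_of_integrable hi
  have h' : Integrable (fun p : En n × En n => u (p.1 + p.2) * v p.1) (volume.prod volume) := by
    refine h.congr (Filter.Eventually.of_forall fun p => ?_)
    simp [mul_comm]
  refine ⟨h', ?_⟩
  rw [← integral_prod_symm (fun p : En n × En n => u (p.1 + p.2) * v p.1) h',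
    integral_prod _ h']
  simp only [integral_mul_const, integral_add_left_eq_self]
  rw [integral_const_mul]

lemma fw_meas {n : ℕ} (d : Fin n → ℝ) (φ ψ : En n → ℂ)
    (hφ : MemLp φ 2 volume) (hψ : MemLp ψ 2 volume) :
    AEStronglyMeasurable (Td d φ ψ) (volume : Measure (En n × En n)) := by
  unfold Td piD
  have hmp := measurePreserving_prod_add (volume : Measure (En n)) (volume : Measure (En n))
  have h1 : AEStronglyMeasurable (fun p : En n × En n => φ (p.1 + p.2)) (volume.prod volume) :=
    hφ.1.comp_quasiMeasurePreserving
      (Measure.quasiMeasurePreserving_snd.comp hmp.quasiMeasurePreserving)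
  have hq : Measure.QuasiMeasurePreserving
      (fun q : (En n × En n) × En n => (q.2, q.1.2))
      ((volume.prod volume).prod volume) (volume.prod volume) := by
    have a : Measure.QuasiMeasurePreserving (fun q : (En n × En n) × En n => (q.1.2, q.2))
      (((volume : Measure (En n)).prod (volume : Measure (En n))).prod volume) (volume.prod volume) :=
      QuasiMeasurePreserving.prodMap (f := Prod.snd) (g := id)
        Measure.quasiMeasurePreserving_snd (Measure.QuasiMeasurePreserving.id _)
    exact (Measure.measurePreserving_swap.quasiMeasurePreserving).comp a
  have h2 := h1.comp_quasiMeasurePreserving hq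
  have h3 : AEStronglyMeasurable (fun q : (En n × En n) × En n => (starRingEnd ℂ) (ψ q.2))
      ((volume.prod volume).prod volume) :=
    Complex.continuous_conj.comp_aestronglyMeasurable
      (hψ.1.comp_quasiMeasurePreserving Measure.quasiMeasurePreserving_snd)
  refine AEStronglyMeasurable.integral_prod_right' (f := fun q : (En n × En n) × En n =>
    Complex.exp (Complex.I *
      ((∑ j, d j * (q.1.1 j * q.2 j + (1 / 2) * (q.1.1 j * q.1.2 j)) : ℝ) : ℂ)) * φ (q.2 + q.1.2) *
      (starRingEnd ℂ) (ψ q.2)) ?_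
  refine AEStronglyMeasurable.mul (AEStronglyMeasurable.mul ?_ h2) h3
  apply Continuous.aestronglyMeasurable
  fun_prop

lemma fw_int {n : ℕ} (φ ψ : En n → ℂ)
    (hφ : MemLp φ 2 volume) (hψ : MemLp ψ 2 volume) :
    Integrable (fun ξ => φ ξ * (starRingEnd ℂ) (ψ ξ)) :=
  hφ.integrable_mul (hψ.star)

lemma fw_sec1 {n : ℕ} (φ ψ : En n → ℂ) (y : En n)
    (hφ : MemLp φ 2 volume) (hψ : MemLp ψ 2 volume) :
    Integrable (fun ξ => φ (ξ + y) * (starRingEnd ℂ) (ψ ξ)) :=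
  fw_int (fun ξ => φ (ξ + y)) ψ
    (hφ.comp_measurePreserving (measurePreserving_add_right volume y)) hψ

lemma fw_sec2 {n : ℕ} (φ ψ : En n → ℂ)
    (hφ : MemLp φ 2 volume) (hψ : MemLp ψ 2 volume) :
    ∀ᵐ y : En n, MemLp (fun ξ => φ (ξ + y) * (starRingEnd ℂ) (ψ ξ)) 2 volume := by
  obtain ⟨h, -⟩ := fw_shear _ _ (fw_int φ φ hφ hφ) (fw_int ψ ψ hψ hψ)
  filter_upwards [h.prod_left_ae] with y hy
  rw [memLp_two_iff_integrable_sq_norm (fw_sec1 φ ψ y hφ hψ).1]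
  refine hy.norm.congr (Filter.Eventually.of_forall fun ξ => ?_)
  simp
  ring

lemma fw_mem {n : ℕ} (d : Fin n → ℝ) (hd : ∀ j, 0 < d j) (φ ψ : En n → ℂ)
    (hφ : MemLp φ 2 volume) (hψ : MemLp ψ 2 volume) :
    MemLp (Td d φ ψ) 2 (volume : Measure (En n × En n)) := by
  have hm := fw_meas d φ ψ hφ hψ
  rw [memLp_two_iff_integrable_sq_norm hm, Measure.volume_eq_prod,
    integrable_prod_iff' (by rw [← Measure.volume_eq_prod]; exact hm.norm.pow 2)]
  constructor
  · filter_upwards [fw_sec2 φ ψ hφ hψ] with y hy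
    exact (fw_slice d hd φ ψ φ ψ y (fw_sec1 φ ψ y hφ hψ) hy
      (fw_sec1 φ ψ y hφ hψ) hy).1.integrable_norm_pow (by norm_num)
  · obtain ⟨h, -⟩ := fw_shear _ _ (fw_int φ φ hφ hφ) (fw_int ψ ψ hψ hψ)
    have h2 := (h.integral_prod_right.const_mul (((2 * Real.pi) ^ n / ∏ j, d j : ℝ) : ℂ)).norm
    refine h2.congr ?_
    filter_upwards [fw_sec2 φ ψ hφ hψ] with y hy
    have h3 := (fw_slice d hd φ ψ φ ψ y (fw_sec1 φ ψ y hφ hψ) hy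
      (fw_sec1 φ ψ y hφ hψ) hy).2
    have h4 : ∫ x, Td d φ ψ (x, y) * (starRingEnd ℂ) (Td d φ ψ (x, y)) =
        ((∫ x, ‖‖Td d φ ψ (x, y)‖ ^ 2‖ : ℝ) : ℂ) := by
      rw [← integral_complex_ofReal]
      refine integral_congr_ae (Filter.Eventually.of_forall fun x => ?_)
      simp [Complex.mul_conj, Complex.normSq_eq_norm_sq]
    rw [h4] at h3
    have h5 := congrArg norm h3
    rw [Complex.norm_real, Real.norm_of_nonneg (integral_nonneg fun _ => norm_nonneg _)] at h5
    rw [h5]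
    congr 3
    ext ξ
    simp
    ring

/-- For all φ₁, ψ₁, φ₂, ψ₂ ∈ L²(ℝⁿ), the Fourier–Wigner transforms
T_d(φ₁,ψ₁) and T_d(φ₂,ψ₂) lie in L²(ℝ²ⁿ) and
∫ T_d(φ₁,ψ₁) conj(T_d(φ₂,ψ₂)) = c(d) ⟨φ₁,φ₂⟩ conj(⟨ψ₁,ψ₂⟩),
where c(d) = (2π)ⁿ / ∏_j d_j. -/
theorem stmt13 {n : ℕ} (hn : 1 ≤ n) (d : Fin n → ℝ) (hd : ∀ j, 0 < d j)
    (φ₁ ψ₁ φ₂ ψ₂ : En n → ℂ)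
    (hφ₁ : MemLp φ₁ 2 (volume : Measure (En n)))
    (hψ₁ : MemLp ψ₁ 2 (volume : Measure (En n)))
    (hφ₂ : MemLp φ₂ 2 (volume : Measure (En n)))
    (hψ₂ : MemLp ψ₂ 2 (volume : Measure (En n))) :
    MemLp (Td d φ₁ ψ₁) 2 (volume : Measure (En n × En n)) ∧
    MemLp (Td d φ₂ ψ₂) 2 (volume : Measure (En n × En n)) ∧
    (∫ v : En n × En n, Td d φ₁ ψ₁ v * (starRingEnd ℂ) (Td d φ₂ ψ₂ v)) =
      (((2 * Real.pi) ^ n / ∏ j, d j : ℝ) : ℂ) *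
        (∫ ξ : En n, φ₁ ξ * (starRingEnd ℂ) (φ₂ ξ)) *
        (starRingEnd ℂ) (∫ ξ : En n, ψ₁ ξ * (starRingEnd ℂ) (ψ₂ ξ)) := by
  have m1 := fw_mem d hd φ₁ ψ₁ hφ₁ hψ₁
  have m2 := fw_mem d hd φ₂ ψ₂ hφ₂ hψ₂
  refine ⟨m1, m2, ?_⟩
  have hI : Integrable (fun v : En n × En n =>
      Td d φ₁ ψ₁ v * (starRingEnd ℂ) (Td d φ₂ ψ₂ v)) (volume.prod volume) :=
    m1.integrable_mul m2.star
  rw [Measure.volume_eq_prod, integral_prod_symm _ hI]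
  obtain ⟨-, h⟩ := fw_shear _ _ (fw_int φ₁ φ₂ hφ₁ hφ₂) (fw_int ψ₂ ψ₁ hψ₂ hψ₁)
  have hc : (starRingEnd ℂ) (∫ ξ : En n, ψ₁ ξ * (starRingEnd ℂ) (ψ₂ ξ)) =
      ∫ ξ : En n, ψ₂ ξ * (starRingEnd ℂ) (ψ₁ ξ) := by
    rw [← integral_conj]
    congr 1
    ext ξ
    simp [mul_comm]
  rw [hc, mul_assoc, ← h, ← integral_const_mul]
  refine integral_congr_ae ?_
  filter_upwards [fw_sec2 φ₁ ψ₁ hφ₁ hψ₁, fw_sec2 φ₂ ψ₂ hφ₂ hψ₂] with y hy1 hy2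
  rw [(fw_slice d hd φ₁ ψ₁ φ₂ ψ₂ y (fw_sec1 φ₁ ψ₁ y hφ₁ hψ₁) hy1
    (fw_sec1 φ₂ ψ₂ y hφ₂ hψ₂) hy2).2]
  congr 2
  ext ξ
  simp
  ring
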